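/- arXiv:2006.04849 — 5 statements merged into one kernel-verified Lean document; each statement's English description precedes it below -/
import Mathlib

section
/- For every continuously differentiable odd function y : [−π/2, π/2] → ℝ (i.e. y(−x) = −y(x)), one has ∫_{−π/2}^{π/2} (y′(x))² cos x dx ≥ 2 ∫_{−π/2}^{π/2} (y(x))² cos x dx. -/
open Real MeasureTheory Set

/-- The Picone function `y² cos² / sin` comparing `y` with the eigenfunction `sin` extends
continuously by zero across a zero of `y` at the origin. -/
theorem continuousOn_sq_mul_cos_sq_div_sin {y : ℝ → ℝ}
    (hy : ContDiffOn ℝ 1 y (Icc (-(π / 2)) (π / 2))) (h0 : y 0 = 0) :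
    ContinuousOn (fun x => y x ^ 2 * Real.cos x ^ 2 / Real.sin x) (Icc (-(π / 2)) (π / 2)) := by
  have hπ := Real.pi_pos
  intro x hx
  rcases eq_or_ne x 0 with rfl | hx0
  · have hd : DifferentiableAt ℝ y 0 :=
      (hy.differentiableOn (by norm_num) 0 hx).differentiableAt
        (Icc_mem_nhds (by linarith) (by linarith))
    have hs : ContinuousAt (dslope y 0) 0 := continuousAt_dslope_same.2 hd
    have heq : (fun x => y x ^ 2 * Real.cos x ^ 2 / Real.sin x) =
        fun x => y x * Real.cos x ^ 2 * dslope y 0 x / Real.sinc x := by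
      funext t
      rcases eq_or_ne t 0 with rfl | ht
      · simp [h0]
      · rw [dslope_of_ne _ ht, slope_def_field, Real.sinc_of_ne_zero ht, h0]
        field_simp
        simp
        ring
    rw [heq]
    have hsinc := Real.continuous_sinc.continuousAt (x := 0)
    exact ((((hd.continuousAt.mul (by fun_prop)).mul hs).div hsinc
      (by simp)).continuousWithinAt)
  · have hsin : Real.sin x ≠ 0 := by
      rcases lt_or_gt_of_ne hx0 with h | h
      · exact (Real.sin_neg_of_neg_of_neg_pi_lt h (by linarith [hx.1])).ne
      · exact (Real.sin_pos_of_pos_of_lt_pi h (by linarith [hx.2])).ne'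
    exact (((hy.continuousOn x hx).pow 2).mul (by fun_prop)).div (by fun_prop) hsin

/-- Picone's inequality with comparison function `sin`, integrated over an interval avoiding
the origin in its interior. -/
theorem sub_le_integral_picone_sin {y : ℝ → ℝ}
    (hy : ContDiffOn ℝ 1 y (Icc (-(π / 2)) (π / 2))) (h0 : y 0 = 0) {a b : ℝ} (hab : a ≤ b)
    (ha : -(π / 2) ≤ a) (hb : b ≤ π / 2) (hab0 : (0 : ℝ) ∉ Ioo a b)
    (hint : ContinuousOn (fun x => derivWithin y (Icc (-(π / 2)) (π / 2)) x ^ 2 * Real.cos x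
      - 2 * (y x ^ 2 * Real.cos x)) (Icc (-(π / 2)) (π / 2))) :
    y b ^ 2 * Real.cos b ^ 2 / Real.sin b - y a ^ 2 * Real.cos a ^ 2 / Real.sin a ≤
      ∫ x in a..b, (derivWithin y (Icc (-(π / 2)) (π / 2)) x ^ 2 * Real.cos x
        - 2 * (y x ^ 2 * Real.cos x)) := by
  have hπ := Real.pi_pos
  have hsub : Icc a b ⊆ Icc (-(π / 2)) (π / 2) := Icc_subset_Icc ha hb
  refine intervalIntegral.sub_le_integral_of_hasDeriv_right_of_le hab
    (g := fun x => y x ^ 2 * Real.cos x ^ 2 / Real.sin x)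
    (g' := fun x => ((2 * y x * derivWithin y (Icc (-(π / 2)) (π / 2)) x) * Real.cos x ^ 2
      + y x ^ 2 * (2 * Real.cos x * -Real.sin x)) / Real.sin x
      - y x ^ 2 * Real.cos x ^ 2 * Real.cos x / Real.sin x ^ 2)
    ((continuousOn_sq_mul_cos_sq_div_sin hy h0).mono hsub) ?_
    ((hint.mono hsub).integrableOn_Icc) ?_
  all_goals
    intro x hx
    have hx1 : -(π / 2) < x := ha.trans_lt hx.1
    have hx2 : x < π / 2 := hx.2.trans_le hb
    have hsin : Real.sin x ≠ 0 := by
      rcases lt_trichotomy x 0 with h | h | h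
      · exact (Real.sin_neg_of_neg_of_neg_pi_lt h (by linarith)).ne
      · exact absurd (h ▸ hx) hab0
      · exact (Real.sin_pos_of_pos_of_lt_pi h (by linarith)).ne'
  · have hd : HasDerivAt y (derivWithin y (Icc (-(π / 2)) (π / 2)) x) x :=
      (hy.differentiableOn (by norm_num) x ⟨hx1.le, hx2.le⟩).hasDerivWithinAt.hasDerivAt
        (Icc_mem_nhds hx1 hx2)
    refine ((((hd.pow 2).mul ((Real.hasDerivAt_cos x).pow 2)).div (Real.hasDerivAt_sin x)
      hsin).congr_deriv ?_).hasDerivWithinAt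
    simp only [Pi.pow_apply, Pi.mul_apply, Nat.cast_ofNat, Nat.add_one_sub_one, pow_one]
    field_simp
  · have hcos : 0 < Real.cos x := Real.cos_pos_of_mem_Ioo ⟨hx1, hx2⟩
    have key := mul_nonneg hcos.le (sq_nonneg
      (derivWithin y (Icc (-(π / 2)) (π / 2)) x - y x * Real.cos x / Real.sin x))
    rw [← sub_nonneg]
    refine key.trans_eq ?_
    field_simp
    ring

/-- The Rayleigh-quotient form of the fact that the first nonzero Neumann eigenvalue of
`(y' cos x)' + μ cos x · y = 0` on `[-π/2, π/2]` equals `2`: for every continuously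
differentiable odd function `y` on `[-π/2, π/2]`,
`∫ (y')² cos x dx ≥ 2 ∫ y² cos x dx`. -/
theorem stmt_0 (y : ℝ → ℝ)
    (hy : ContDiffOn ℝ 1 y (Icc (-(π/2)) (π/2)))
    (hodd : ∀ x ∈ Icc (-(π/2)) (π/2), y (-x) = - y x) :
    ∫ x in (-(π/2))..(π/2),
        (derivWithin y (Icc (-(π/2)) (π/2)) x)^2 * Real.cos x
      ≥ 2 * ∫ x in (-(π/2))..(π/2), (y x)^2 * Real.cos x := by
  have hπ := Real.pi_pos
  have h0 : y 0 = 0 := by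
    have h := hodd 0 ⟨by linarith, by linarith⟩
    rw [neg_zero] at h
    linarith
  have hc' : ContinuousOn (derivWithin y (Icc (-(π / 2)) (π / 2))) (Icc (-(π / 2)) (π / 2)) :=
    hy.continuousOn_derivWithin (uniqueDiffOn_Icc (by linarith)) le_rfl
  have hc1 : ContinuousOn (fun x => derivWithin y (Icc (-(π / 2)) (π / 2)) x ^ 2 * Real.cos x)
      (Icc (-(π / 2)) (π / 2)) := (hc'.pow 2).mul (by fun_prop)
  have hc2 : ContinuousOn (fun x => y x ^ 2 * Real.cos x) (Icc (-(π / 2)) (π / 2)) :=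
    (hy.continuousOn.pow 2).mul (by fun_prop)
  have hc : ContinuousOn (fun x => derivWithin y (Icc (-(π / 2)) (π / 2)) x ^ 2 * Real.cos x
      - 2 * (y x ^ 2 * Real.cos x)) (Icc (-(π / 2)) (π / 2)) := hc1.sub (hc2.const_smul (2 : ℝ))
  have hi1 := hc1.intervalIntegrable_of_Icc (μ := volume) (by linarith)
  have hi2 := hc2.intervalIntegrable_of_Icc (μ := volume) (by linarith)
  have hneg := sub_le_integral_picone_sin hy h0 (a := -(π / 2)) (b := 0) (by linarith) le_rfl
    (by linarith) (by simp) hc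
  have hpos := sub_le_integral_picone_sin hy h0 (a := 0) (b := π / 2) (by linarith)
    (by linarith) le_rfl (by simp) hc
  have hadd := intervalIntegral.integral_add_adjacent_intervals (μ := volume)
    ((hc.mono (Icc_subset_Icc le_rfl (by linarith))).intervalIntegrable_of_Icc
      (a := -(π / 2)) (b := 0) (by linarith))
    ((hc.mono (Icc_subset_Icc (by linarith) le_rfl)).intervalIntegrable_of_Icc
      (a := 0) (b := π / 2) (by linarith))
  rw [intervalIntegral.integral_sub hi1 (hi2.const_mul 2),
    intervalIntegral.integral_const_mul] at hadd
  simp only [Real.cos_neg, Real.cos_pi_div_two, h0] at hneg hpos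
  norm_num at hneg hpos
  linarith
end

section
/- Let y : ℝ → ℝ be a bounded, continuously differentiable odd function whose derivative is square integrable on ℝ. Then ∫_ℝ (y′(u))² du ≥ 2 ∫_ℝ (y(u))² sech²(u) du, where sech(u) = 1/cosh(u). -/
open Real MeasureTheory Set

lemma integrable_one_div_cosh_sq : Integrable (fun u : ℝ => (1 / Real.cosh u) ^ 2) := by
  refine integrable_inv_one_add_sq.mono' ?_ (Filter.Eventually.of_forall fun u => ?_)
  · exact (continuous_const.div Real.continuous_cosh
      fun u => (Real.cosh_pos u).ne').pow 2 |>.aestronglyMeasurable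
  · have h : u ^ 2 ≤ Real.sinh u ^ 2 := by
      rcases le_total 0 u with hu | hu
      · exact pow_le_pow_left₀ hu (Real.self_le_sinh_iff.2 hu) 2
      · nlinarith [Real.sinh_le_self_iff.2 hu]
    rw [Real.norm_of_nonneg (by positivity), div_pow, one_pow, one_div]
    gcongr
    linarith [Real.cosh_sq u]

lemma continuousWithinAt_sq_div_sinh_mul_cosh {y : ℝ → ℝ} (hy : DifferentiableAt ℝ y 0)
    (h0 : y 0 = 0) :
    ContinuousWithinAt (fun u => y u ^ 2 / (Real.sinh u * Real.cosh u)) (Ici 0) 0 := by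
  rw [← continuousWithinAt_Ioi_iff_Ici]
  have hslope : Filter.Tendsto (fun u => y u ^ 2 / u) (nhdsWithin 0 (Ioi 0)) (nhds 0) := by
    have h1 := hy.hasDerivAt.tendsto_slope.mono_left
      (nhdsWithin_mono 0 fun u (hu : 0 < u) => hu.ne')
    have h2 : Filter.Tendsto y (nhdsWithin 0 (Ioi 0)) (nhds 0) := by
      simpa [h0] using hy.continuousAt.tendsto.mono_left nhdsWithin_le_nhds
    have h3 := h2.mul h1
    rw [zero_mul] at h3
    refine h3.congr fun u => ?_
    simp [slope_def_field, h0]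
    ring
  have hle : ∀ u ∈ Ioi (0 : ℝ), y u ^ 2 / (Real.sinh u * Real.cosh u) ≤ y u ^ 2 / u := by
    intro u (hu : 0 < u)
    have h1 := Real.self_le_sinh_iff.2 hu.le
    have h2 := Real.one_le_cosh u
    gcongr
    nlinarith
  have hnonneg : ∀ u ∈ Ioi (0 : ℝ), 0 ≤ y u ^ 2 / (Real.sinh u * Real.cosh u) := by
    intro u hu
    have := Real.sinh_pos_iff.2 hu
    positivity
  have h := squeeze_zero' (Filter.eventually_of_mem self_mem_nhdsWithin hnonneg)
    (Filter.eventually_of_mem self_mem_nhdsWithin hle) hslope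
  simpa [ContinuousWithinAt, h0] using h

/-- On `[0, b]` the weighted inequality holds because the integrand dominates the derivative of
`y² / (sinh · cosh)`, which vanishes at `0` and is nonnegative at `b`. -/
lemma intervalIntegral_deriv_sq_sub_nonneg {y : ℝ → ℝ} (hy : ContDiff ℝ 1 y) (h0 : y 0 = 0)
    {b : ℝ} (hb : 0 ≤ b) :
    0 ≤ ∫ u in (0 : ℝ)..b, (deriv y u ^ 2 - 2 * (y u ^ 2 * (1 / Real.cosh u) ^ 2)) := by
  have hd : Differentiable ℝ y := hy.differentiable one_ne_zero
  have hderiv : ∀ u : ℝ, 0 < u → HasDerivAt (fun u => y u ^ 2 / (Real.sinh u * Real.cosh u))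
      ((2 * y u * deriv y u * (Real.sinh u * Real.cosh u) -
        y u ^ 2 * (Real.cosh u * Real.cosh u + Real.sinh u * Real.sinh u)) /
          (Real.sinh u * Real.cosh u) ^ 2) u := by
    intro u hu
    have hs := Real.sinh_pos_iff.2 hu
    have hc := Real.cosh_pos u
    simpa using ((hd u).hasDerivAt.pow 2).fun_div
      ((Real.hasDerivAt_sinh u).fun_mul (Real.hasDerivAt_cosh u)) (mul_pos hs hc).ne'
  have hcont : Continuous fun u => deriv y u ^ 2 - 2 * (y u ^ 2 * (1 / Real.cosh u) ^ 2) := by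
    have h1 := hy.continuous_deriv le_rfl
    have h2 := hy.continuous
    have h3 : Continuous fun u : ℝ => 1 / Real.cosh u :=
      continuous_const.div Real.continuous_cosh fun u => (Real.cosh_pos u).ne'
    fun_prop
  have key := intervalIntegral.sub_le_integral_of_hasDeriv_right_of_le
    (g := fun u => y u ^ 2 / (Real.sinh u * Real.cosh u)) hb ?_
    (fun u hu => (hderiv u hu.1).hasDerivWithinAt) (hcont.integrableOn_Icc) ?_
  · have hG : 0 ≤ y b ^ 2 / (Real.sinh b * Real.cosh b) := by
      have := Real.sinh_nonneg_iff.2 hb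
      positivity
    simp only [h0] at key
    norm_num at key ⊢
    linarith
  · intro u hu
    rcases hu.1.eq_or_lt with rfl | hpos
    · exact (continuousWithinAt_sq_div_sinh_mul_cosh (hd 0) h0).mono Icc_subset_Ici_self
    · exact (hderiv u hpos).continuousAt.continuousWithinAt
  · intro u hu
    have hs := Real.sinh_pos_iff.2 hu.1
    have hc := Real.cosh_pos u
    rw [div_le_iff₀ (by positivity)]
    have h : (deriv y u ^ 2 - 2 * (y u ^ 2 * (1 / Real.cosh u) ^ 2)) *
        (Real.sinh u * Real.cosh u) ^ 2 =
        deriv y u ^ 2 * (Real.sinh u * Real.cosh u) ^ 2 - 2 * y u ^ 2 * Real.sinh u ^ 2 := by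
      field_simp
    rw [h]
    have hsq := congrArg (y u ^ 2 * ·) (Real.cosh_sq u)
    nlinarith [sq_nonneg (deriv y u * (Real.sinh u * Real.cosh u) - y u)]

/-- Infinite-interval Poincaré-type inequality: if `y : ℝ → ℝ` is a bounded, continuously
differentiable odd function whose derivative is square integrable, then
`∫_ℝ (y')² du ≥ 2 ∫_ℝ y² sech²(u) du`, where `sech u = 1 / cosh u`. -/
theorem stmt_1 (y : ℝ → ℝ)
    (hb : ∃ M : ℝ, ∀ u, |y u| ≤ M)
    (hy : ContDiff ℝ 1 y)
    (hodd : ∀ u, y (-u) = - y u)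
    (hint : Integrable (fun u => (deriv y u)^2)) :
    ∫ u, (deriv y u)^2 ≥ 2 * ∫ u, (y u)^2 * (1 / Real.cosh u)^2 := by
  obtain ⟨M, hM⟩ := hb
  have h0 : y 0 = 0 := by
    have := hodd 0
    rw [neg_zero] at this
    linarith
  have hint' : Integrable fun u => y u ^ 2 * (1 / Real.cosh u) ^ 2 := by
    refine integrable_one_div_cosh_sq.bdd_mul (c := M ^ 2)
      (hy.continuous.pow 2).aestronglyMeasurable (Filter.Eventually.of_forall fun u => ?_)
    rw [Real.norm_of_nonneg (by positivity), ← sq_abs]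
    exact pow_le_pow_left₀ (abs_nonneg _) (hM u) 2
  have hderiv_even : ∀ u, deriv y (-u) = deriv y u := by
    intro u
    have h := deriv_comp_neg y u
    simp only [hodd, deriv.fun_neg] at h
    linarith
  have hsub := hint.sub (hint'.const_mul 2)
  have hIoi : 0 ≤ ∫ u in Ioi (0 : ℝ),
      (deriv y u ^ 2 - 2 * (y u ^ 2 * (1 / Real.cosh u) ^ 2)) :=
    ge_of_tendsto (intervalIntegral_tendsto_integral_Ioi 0 hsub.integrableOn Filter.tendsto_id)
      ((Filter.eventually_ge_atTop 0).mono fun b hb =>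
        intervalIntegral_deriv_sq_sub_nonneg hy h0 hb)
  have hfull : 0 ≤ ∫ u, (deriv y u ^ 2 - 2 * (y u ^ 2 * (1 / Real.cosh u) ^ 2)) := by
    have habs := integral_comp_abs
      (f := fun u => deriv y u ^ 2 - 2 * (y u ^ 2 * (1 / Real.cosh u) ^ 2))
    have heven : ∀ u, deriv y |u| ^ 2 - 2 * (y |u| ^ 2 * (1 / Real.cosh |u|) ^ 2) =
        deriv y u ^ 2 - 2 * (y u ^ 2 * (1 / Real.cosh u) ^ 2) := by
      intro u
      rcases abs_choice u with h | h <;> simp [h, hderiv_even, hodd]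
    simp only [heven] at habs
    rw [habs]
    positivity
  rw [integral_sub hint (hint'.const_mul 2), integral_const_mul] at hfull
  linarith
end

section
/- Let T > 0 and let y : [−T, T] → ℝ be a continuously differentiable odd function with y′(−T) = y′(T) = 0 and |y(u)| ≤ |y(T)| for all u ∈ [−T, T]. Then ∫_{−T}^{T} (y′(u))² du ≥ (4 − 2 tanh(T)) · ∫_{−T}^{T} (y(u))² sech²(u) du. -/
open Real MeasureTheory Set

/-- If `y` is differentiable and vanishes at `0`, then `y² / (sinh · cosh)`, extended by `0`,
is differentiable at `0`. -/
lemma hasDerivAt_sq_div_sinh_mul_cosh_zero {y : ℝ → ℝ} {d : ℝ} (h0 : y 0 = 0)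
    (hy : HasDerivAt y d 0) :
    HasDerivAt (fun u => y u ^ 2 / (sinh u * cosh u)) (d ^ 2) 0 := by
  have hs : HasDerivAt (fun u => sinh u * cosh u) 1 0 := by
    have h := (hasDerivAt_sinh 0).mul (hasDerivAt_cosh 0)
    simp only [sinh_zero, cosh_zero, mul_one, zero_mul, add_zero] at h
    exact h
  rw [hasDerivAt_iff_tendsto_slope] at hy hs ⊢
  have h := (hy.pow 2).div hs one_ne_zero
  rw [div_one] at h
  refine h.congr' ?_
  filter_upwards [self_mem_nhdsWithin] with u hu
  have hu : u ≠ 0 := hu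
  have hsu : sinh u ≠ 0 := by simpa using hu
  have hcu := (cosh_pos u).ne'
  simp only [Pi.div_apply, slope_def_field, h0, sinh_zero, zero_mul, sub_zero]
  field_simp
  simp

/-- Away from `0`, the derivative of `y² / (sinh · cosh)` is at most `y'² - 2 y² sech²`. -/
lemma exists_hasDerivAt_sq_div_sinh_mul_cosh_le {y : ℝ → ℝ} {d u : ℝ} (hu : u ≠ 0)
    (hy : HasDerivAt y d u) :
    ∃ e, HasDerivAt (fun u => y u ^ 2 / (sinh u * cosh u)) e u ∧
      e ≤ d ^ 2 - 2 * (y u ^ 2 * (1 / cosh u) ^ 2) := by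
  have hs : sinh u ≠ 0 := by simpa using hu
  have hc := (cosh_pos u).ne'
  refine ⟨_, (hy.pow 2).div ((hasDerivAt_sinh u).mul (hasDerivAt_cosh u))
    (mul_ne_zero hs hc), ?_⟩
  rw [← sub_nonneg]
  have hsq : 0 ≤ (d - y u / (sinh u * cosh u)) ^ 2 := sq_nonneg _
  convert hsq using 1
  have hcs := cosh_sq u
  simp only [Pi.pow_apply]
  field_simp
  push_cast
  ring_nf
  simp only [hcs]
  ring

lemma integral_sech_sq (a b : ℝ) : ∫ u in a..b, (1 / cosh u) ^ 2 = tanh b - tanh a := by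
  refine intervalIntegral.integral_eq_sub_of_hasDerivAt (fun u _ => ?_) ?_
  · have h := (hasDerivAt_sinh u).div (hasDerivAt_cosh u) (cosh_pos u).ne'
    have heq : sinh / cosh = tanh := by ext x; simp [tanh_eq_sinh_div_cosh]
    rw [heq] at h
    have hval : (cosh u * cosh u - sinh u * sinh u) / cosh u ^ 2 = (1 / cosh u) ^ 2 := by
      rw [← sq, ← sq, cosh_sq_sub_sinh_sq, div_pow, one_pow]
    rwa [hval] at h
  · exact (continuous_const.div continuous_cosh fun u => (cosh_pos u).ne').pow 2
      |>.intervalIntegrable _ _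

/-- Hardy-type inequality with boundary term, obtained from the ground state `tanh`. -/
lemma sq_div_sinh_mul_cosh_le_integral {T : ℝ} (hT : 0 < T) {y d : ℝ → ℝ}
    (h0 : y 0 = 0) (hyc : ContinuousOn y (Icc (-T) T)) (hdc : ContinuousOn d (Icc (-T) T))
    (hd : ∀ u ∈ Ioo (-T) T, HasDerivAt y (d u) u) :
    (y T ^ 2 + y (-T) ^ 2) / (sinh T * cosh T) ≤
      ∫ u in (-T)..T, (d u ^ 2 - 2 * (y u ^ 2 * (1 / cosh u) ^ 2)) := by
  have key : ∀ u ∈ Ioo (-T) T, ∃ e, HasDerivAt (fun u => y u ^ 2 / (sinh u * cosh u)) e u ∧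
      e ≤ d u ^ 2 - 2 * (y u ^ 2 * (1 / cosh u) ^ 2) := by
    intro u hu
    rcases eq_or_ne u 0 with rfl | hne
    · exact ⟨_, hasDerivAt_sq_div_sinh_mul_cosh_zero h0 (hd 0 hu), by simp [h0]⟩
    · exact exists_hasDerivAt_sq_div_sinh_mul_cosh_le hne (hd u hu)
  choose! e he hle using key
  have hcont : ContinuousOn (fun u => y u ^ 2 / (sinh u * cosh u)) (Icc (-T) T) := by
    intro u hu
    rcases eq_or_ne u 0 with rfl | hne
    · exact (he 0 ⟨by linarith, hT⟩).continuousAt.continuousWithinAt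
    · refine ((hyc u hu).pow 2).div (by fun_prop) (mul_ne_zero ?_ (cosh_pos u).ne')
      simpa using hne
  have hsech : Continuous fun u => (1 / cosh u) ^ 2 :=
    (continuous_const.div continuous_cosh fun u => (cosh_pos u).ne').pow 2
  have h := intervalIntegral.sub_le_integral_of_hasDeriv_right_of_le (by linarith) hcont
    (fun u hu => (he u hu).hasDerivWithinAt)
    (((hdc.pow 2).sub (continuousOn_const.mul
      ((hyc.pow 2).mul hsech.continuousOn))).integrableOn_Icc) hle
  refine le_trans (le_of_eq ?_) h
  simp only [sinh_neg, cosh_neg]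
  rw [neg_mul, div_neg]
  ring

/-- Analytic core of the appendix lemma: if `y` is a continuously differentiable odd
function on `[-T, T]` with `y'(±T) = 0` and `|y u| ≤ |y T|` on `[-T, T]`, then
`∫_{-T}^{T} (y')² du ≥ (4 - 2 tanh T) ∫_{-T}^{T} y² sech²(u) du`. -/
theorem stmt_3 (T : ℝ) (hT : 0 < T) (y : ℝ → ℝ)
    (hy : ContDiffOn ℝ 1 y (Icc (-T) T))
    (hodd : ∀ u ∈ Icc (-T) T, y (-u) = - y u)
    (hbc1 : derivWithin y (Icc (-T) T) (-T) = 0)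
    (hbc2 : derivWithin y (Icc (-T) T) T = 0)
    (hmax : ∀ u ∈ Icc (-T) T, |y u| ≤ |y T|) :
    ∫ u in (-T)..T, (derivWithin y (Icc (-T) T) u)^2
      ≥ (4 - 2 * Real.tanh T) * ∫ u in (-T)..T, (y u)^2 * (1 / Real.cosh u)^2 := by
  have hTT : -T ≤ T := by linarith
  have h0 : y 0 = 0 := by
    have := hodd 0 ⟨by linarith, hT.le⟩
    rw [neg_zero] at this
    linarith
  have hyc := hy.continuousOn
  have hdc : ContinuousOn (derivWithin y (Icc (-T) T)) (Icc (-T) T) :=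
    hy.continuousOn_derivWithin (uniqueDiffOn_Icc (by linarith)) le_rfl
  have hsech : Continuous fun u => (1 / cosh u) ^ 2 :=
    (continuous_const.div continuous_cosh fun u => (cosh_pos u).ne').pow 2
  have hpot : IntervalIntegrable (fun u => y u ^ 2 * (1 / cosh u) ^ 2) volume (-T) T :=
    ((hyc.pow 2).mul hsech.continuousOn).intervalIntegrable_of_Icc hTT
  have hhardy := sq_div_sinh_mul_cosh_le_integral hT h0 hyc hdc fun u hu =>
    ((hy.differentiableOn one_ne_zero u (Ioo_subset_Icc_self hu)).hasDerivWithinAt).hasDerivAt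
      (Icc_mem_nhds hu.1 hu.2)
  have hkin : IntervalIntegrable (fun u => derivWithin y (Icc (-T) T) u ^ 2) volume (-T) T :=
    (hdc.pow 2).intervalIntegrable_of_Icc hTT
  rw [intervalIntegral.integral_sub hkin (hpot.const_mul 2), intervalIntegral.integral_const_mul,
    hodd T (right_mem_Icc.2 hTT), neg_sq] at hhardy
  have hupper : ∫ u in (-T)..T, y u ^ 2 * (1 / cosh u) ^ 2 ≤ y T ^ 2 * (2 * tanh T) := by
    calc
      _ ≤ ∫ u in (-T)..T, y T ^ 2 * (1 / cosh u) ^ 2 :=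
        intervalIntegral.integral_mono_on hTT hpot
          ((hsech.const_mul _).intervalIntegrable _ _)
          fun u hu => mul_le_mul_of_nonneg_right (sq_le_sq.2 (hmax u hu)) (sq_nonneg _)
      _ = _ := by
        rw [intervalIntegral.integral_const_mul, integral_sech_sq, tanh_neg]
        ring
  have hs : 0 < sinh T := sinh_pos_iff.2 hT
  have hc := cosh_pos T
  have ht1 : tanh T < 1 := tanh_lt_one T
  have ht0 : 0 < tanh T := by rw [tanh_eq_sinh_div_cosh]; positivity
  have hinv : 1 / (sinh T * cosh T) = (1 - tanh T ^ 2) / tanh T := by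
    have := cosh_sq T
    rw [tanh_eq_sinh_div_cosh]
    field_simp
    linarith
  have hbd : 2 * tanh T * (1 - tanh T) ≤ 1 / (sinh T * cosh T) := by
    rw [hinv, le_div_iff₀ ht0]
    nlinarith [mul_nonneg (sub_nonneg.2 ht1.le) (sub_nonneg.2 ht1.le), mul_pos ht0 (sub_pos.2 ht1)]
  have hprod := mul_le_mul_of_nonneg_left hupper (sub_nonneg.2 ht1.le)
  have hM := mul_le_mul_of_nonneg_left hbd (sq_nonneg (y T))
  have hsplit : (y T ^ 2 + y T ^ 2) / (sinh T * cosh T)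
      = 2 * (y T ^ 2 * (1 / (sinh T * cosh T))) := by ring
  rw [hsplit] at hhardy
  linarith
end

section
/- Let T > 0, μ ∈ ℝ, and let y : [−T, T] → ℝ be a twice continuously differentiable odd function, not identically zero, satisfying y″(u) + μ sech²(u) y(u) = 0 for all u ∈ [−T, T], y′(−T) = y′(T) = 0, and y′(u) ≥ 0 for all u ∈ [−T, T]. Then μ ≥ 2 + 2(1 − tanh(T)) = 4 − 2 tanh(T). -/
open Real MeasureTheory Set

/-- The derivative of `tanh` is `sech²`. -/
theorem hasDerivAt_tanh_sech_sq (u : ℝ) : HasDerivAt Real.tanh ((1 / Real.cosh u) ^ 2) u := by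
  have hc := (Real.cosh_pos u).ne'
  have h := (Real.hasDerivAt_sinh u).div (Real.hasDerivAt_cosh u) hc
  have hf : Real.tanh = Real.sinh / Real.cosh := funext Real.tanh_eq_sinh_div_cosh
  rw [hf]
  refine h.congr_deriv ?_
  field_simp
  linarith [Real.cosh_sq u]

theorem sech_sq_eq_one_sub_tanh_sq (u : ℝ) :
    (1 / Real.cosh u) ^ 2 = 1 - Real.tanh u ^ 2 := by
  have hc := (Real.cosh_pos u).ne'
  rw [Real.tanh_eq_sinh_div_cosh]
  field_simp
  linarith [Real.cosh_sq u]

/-- If `y'' = -μ sech² y`, `y 0 = 0`, `y' T = 0` and `(μ - 2) (c - y) ≥ 0` on `[0, T]`, then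
pairing the equation with the solution `tanh` of the equation for `μ = 2` bounds `y T`. -/
theorem sech_sq_mul_le_of_neumann {T μ c : ℝ} (hT : 0 < T) {y p : ℝ → ℝ}
    (hy : ∀ u ∈ Icc 0 T, HasDerivWithinAt y (p u) (Icc 0 T) u)
    (hp : ∀ u ∈ Icc 0 T, HasDerivWithinAt p (-(μ * (1 / Real.cosh u) ^ 2 * y u)) (Icc 0 T) u)
    (hy0 : y 0 = 0) (hpT : p T = 0) (hc : ∀ u ∈ Icc 0 T, 0 ≤ (μ - 2) * (c - y u)) :
    y T * (1 - Real.tanh T ^ 2) ≤ (μ - 2) * c / 2 * Real.tanh T ^ 2 := by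
  have hG : ∀ u ∈ Icc 0 T, HasDerivWithinAt
      (fun u => p u * Real.tanh u - y u * (1 - Real.tanh u ^ 2)
        + (μ - 2) * c / 2 * Real.tanh u ^ 2)
      ((μ - 2) * (c - y u) * ((1 / Real.cosh u) ^ 2 * Real.tanh u)) (Icc 0 T) u := by
    intro u hu
    have ht := (hasDerivAt_tanh_sech_sq u).hasDerivWithinAt (s := Icc 0 T)
    have h := (((hp u hu).fun_mul ht).fun_sub
      ((hy u hu).fun_mul ((ht.fun_pow 2).const_sub 1))).fun_add
        ((ht.fun_pow 2).const_mul ((μ - 2) * c / 2))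
    refine h.congr_deriv ?_
    rw [sech_sq_eq_one_sub_tanh_sq]
    push_cast
    ring
  have hmono := monotoneOn_of_hasDerivWithinAt_nonneg (convex_Icc 0 T)
    (fun u hu => (hG u hu).continuousWithinAt)
    (fun u hu => (hG u (interior_subset hu)).mono interior_subset)
    (fun u hu => mul_nonneg (hc u (interior_subset hu)) (mul_nonneg (by positivity)
      (by
        rw [Real.tanh_eq_sinh_div_cosh]
        exact div_nonneg (Real.sinh_nonneg_iff.2 (interior_subset hu).1) (Real.cosh_pos u).le)))
  have h := hmono (left_mem_Icc.2 hT.le) (right_mem_Icc.2 hT.le) hT.le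
  simp only [hy0, hpT, Real.tanh_zero] at h
  linarith


/-- Appendix lemma in hyperbolic coordinates: if `y` is a twice continuously
differentiable odd function on `[-T, T]`, not identically zero, satisfying
`y'' + μ sech²(u) y = 0` with Neumann conditions `y'(±T) = 0` and `y' ≥ 0`, then
`μ ≥ 2 + 2 (1 - tanh T) = 4 - 2 tanh T`. -/
theorem stmt_4 (T μ : ℝ) (hT : 0 < T) (y : ℝ → ℝ)
    (hy : ContDiffOn ℝ 2 y (Icc (-T) T))
    (hodd : ∀ u ∈ Icc (-T) T, y (-u) = - y u)
    (hne : ∃ u ∈ Icc (-T) T, y u ≠ 0)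
    (hode : ∀ u ∈ Icc (-T) T,
      derivWithin (derivWithin y (Icc (-T) T)) (Icc (-T) T) u
        + μ * (1 / Real.cosh u)^2 * y u = 0)
    (hbc1 : derivWithin y (Icc (-T) T) (-T) = 0)
    (hbc2 : derivWithin y (Icc (-T) T) T = 0)
    (hmono : ∀ u ∈ Icc (-T) T, 0 ≤ derivWithin y (Icc (-T) T) u) :
    μ ≥ 2 + 2 * (1 - Real.tanh T) := by
  have huniq := uniqueDiffOn_Icc (show -T < T by linarith)
  have hsub : Icc 0 T ⊆ Icc (-T) T := Icc_subset_Icc_left (by linarith)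
  have hTm : T ∈ Icc (-T) T := ⟨by linarith, le_rfl⟩
  have hdy : ∀ u ∈ Icc (-T) T,
      HasDerivWithinAt y (derivWithin y (Icc (-T) T) u) (Icc (-T) T) u :=
    fun u hu => (hy.differentiableOn (by norm_num) u hu).hasDerivWithinAt
  have hdp : ∀ u ∈ Icc (-T) T, HasDerivWithinAt (derivWithin y (Icc (-T) T))
      (-(μ * (1 / Real.cosh u) ^ 2 * y u)) (Icc (-T) T) u := fun u hu =>
    (((hy.derivWithin huniq (m := 1) (by norm_num)).differentiableOn (by norm_num)
      u hu).hasDerivWithinAt).congr_deriv (by linarith [hode u hu])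
  have hymono : MonotoneOn y (Icc (-T) T) :=
    monotoneOn_of_hasDerivWithinAt_nonneg (convex_Icc _ _) hy.continuousOn
      (fun u hu => (hdy u (interior_subset hu)).mono interior_subset)
      (fun u hu => hmono u (interior_subset hu))
  have hy0 : y 0 = 0 := by
    have h := hodd 0 (hsub ⟨le_rfl, hT.le⟩)
    rw [neg_zero] at h
    linarith
  have hyT : 0 < y T := by
    obtain ⟨u, hu, hu0⟩ := hne
    have h1 := hymono hu hTm hu.2
    have h2 := hymono (show -u ∈ Icc (-T) T from ⟨by linarith [hu.2], by linarith [hu.1]⟩) hTm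
      (by linarith [hu.1])
    rw [hodd u hu] at h2
    rcases lt_or_gt_of_ne hu0 with h | h <;> linarith
  have key := fun (c : ℝ) => sech_sq_mul_le_of_neumann (c := c) hT
    (fun u hu => (hdy u (hsub hu)).mono hsub) (fun u hu => (hdp u (hsub hu)).mono hsub) hy0 hbc2
  have hsech : 0 < 1 - Real.tanh T ^ 2 := sub_pos.2 (Real.tanh_sq_lt_one T)
  have hμ : 2 ≤ μ := by
    by_contra! hlt
    have h := key 0 fun u hu => by
      have := hymono (hsub ⟨le_rfl, hT.le⟩) (hsub hu) hu.1
      nlinarith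
    have := mul_pos hyT hsech
    simp only [mul_zero, zero_div, zero_mul] at h
    linarith
  have h := key (y T) fun u hu =>
    mul_nonneg (by linarith) (by linarith [hymono (hsub hu) hTm hu.2])
  have h' : 1 - Real.tanh T ^ 2 ≤ (μ - 2) / 2 * Real.tanh T ^ 2 :=
    le_of_mul_le_mul_left (by linarith) hyT
  have hpos : 0 < Real.tanh T := by
    rw [Real.tanh_eq_sinh_div_cosh]
    exact div_pos (Real.sinh_pos_iff.2 hT) (Real.cosh_pos T)
  have hlt := Real.tanh_lt_one T
  by_contra! hμlt
  have h1 : (μ - 2) / 2 * Real.tanh T ^ 2 ≤ (1 - Real.tanh T) * Real.tanh T ^ 2 :=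
    mul_le_mul_of_nonneg_right (by linarith) (sq_nonneg _)
  nlinarith [mul_pos (sub_pos.2 hlt) hpos, mul_pos (sub_pos.2 hlt) hsech]
end

section
/- Let 0 < d ≤ π, μ ∈ ℝ, and let y : [−d/2, d/2] → ℝ be a twice continuously differentiable odd function, not identically zero, satisfying (y′(x) cos x)′ + μ cos(x) y(x) = 0 for all x ∈ [−d/2, d/2], y′(−d/2) = y′(d/2) = 0, and y′(x) ≥ 0 for all x ∈ [−d/2, d/2]. Then μ ≥ 2 + 2(1 − sin(d/2)). -/
open Real MeasureTheory Set
open scoped Topology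

/-- Lemma 5.2 of the paper: for the Sturm–Liouville problem
`(y' cos x)' + μ cos x · y = 0` on `[-d/2, d/2]` with Neumann boundary conditions, if `y`
is a twice continuously differentiable odd, monotone (`y' ≥ 0`), not identically zero
solution, then `μ ≥ 2 + 2 (1 - sin (d/2))`. -/
theorem stmt_5 (d μ : ℝ) (hd0 : 0 < d) (hdπ : d ≤ π) (y : ℝ → ℝ)
    (hy : ContDiffOn ℝ 2 y (Icc (-(d/2)) (d/2)))
    (hodd : ∀ x ∈ Icc (-(d/2)) (d/2), y (-x) = - y x)
    (hne : ∃ x ∈ Icc (-(d/2)) (d/2), y x ≠ 0)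
    (hode : ∀ x ∈ Icc (-(d/2)) (d/2),
      derivWithin (fun t => derivWithin y (Icc (-(d/2)) (d/2)) t * Real.cos t)
        (Icc (-(d/2)) (d/2)) x + μ * Real.cos x * y x = 0)
    (hbc1 : derivWithin y (Icc (-(d/2)) (d/2)) (-(d/2)) = 0)
    (hbc2 : derivWithin y (Icc (-(d/2)) (d/2)) (d/2) = 0)
    (hmono : ∀ x ∈ Icc (-(d/2)) (d/2), 0 ≤ derivWithin y (Icc (-(d/2)) (d/2)) x) :
    μ ≥ 2 + 2 * (1 - Real.sin (d/2)) := by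
  set s := d / 2 with hs
  set K := Icc (-s) s
  set z := derivWithin y K
  have hs0 : 0 < s := by positivity
  have hsπ : s ≤ π / 2 := by linarith
  have huniq : UniqueDiffOn ℝ K := uniqueDiffOn_Icc (by linarith)
  have hsK : s ∈ K := ⟨by linarith, le_rfl⟩
  have h0K : (0 : ℝ) ∈ K := ⟨by linarith, hs0.le⟩
  have hzdiff : DifferentiableOn ℝ z K :=
    (hy.derivWithin huniq (m := 1) (by norm_num)).differentiableOn (by norm_num)
  have hydiff : DifferentiableOn ℝ y K := hy.differentiableOn (by norm_num)
  have hnhds : ∀ x ∈ Ioo 0 s, K ∈ 𝓝 x := fun x hx =>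
    Icc_mem_nhds (by linarith [hx.1]) hx.2
  have hyderiv : ∀ x ∈ Ioo 0 s, HasDerivAt y (z x) x := fun x hx =>
    ((hydiff x (mem_of_mem_nhds (hnhds x hx))).hasDerivWithinAt).hasDerivAt (hnhds x hx)
  have hflux : ∀ x ∈ Ioo 0 s,
      HasDerivAt (fun t => z t * Real.cos t) (-(μ * Real.cos x * y x)) x := by
    intro x hx
    have hxK := mem_of_mem_nhds (hnhds x hx)
    have h : DifferentiableWithinAt ℝ (fun t => z t * Real.cos t) K x :=
      (hzdiff x hxK).mul Real.differentiable_cos.differentiableAt.differentiableWithinAt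
    rw [← eq_neg_of_add_eq_zero_left (hode x hxK)]
    exact h.hasDerivWithinAt.hasDerivAt (hnhds x hx)
  have hymono : MonotoneOn y (Icc 0 s) := by
    refine monotoneOn_of_deriv_nonneg (convex_Icc 0 s)
      (hydiff.continuousOn.mono (Icc_subset_Icc_left (by linarith))) ?_ ?_
    · rw [interior_Icc]
      exact fun x hx => (hyderiv x hx).differentiableAt.differentiableWithinAt
    · rw [interior_Icc]
      intro x hx
      rw [(hyderiv x hx).deriv]
      exact hmono x (mem_of_mem_nhds (hnhds x hx))
  have hy0 : y 0 = 0 := by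
    have h := hodd 0 h0K
    rw [neg_zero] at h
    linarith
  have hynonneg : ∀ x ∈ Icc 0 s, 0 ≤ y x := fun x hx =>
    hy0 ▸ hymono ⟨le_rfl, hs0.le⟩ hx hx.1
  have hyle : ∀ x ∈ Icc 0 s, y x ≤ y s := fun x hx => hymono hx ⟨hs0.le, le_rfl⟩ hx.2
  have hys : 0 < y s := by
    obtain ⟨x, hx, hyx⟩ := hne
    rcases le_total 0 x with h | h
    · have hx' : x ∈ Icc 0 s := ⟨h, hx.2⟩
      exact ((hynonneg x hx').lt_of_ne hyx.symm).trans_le (hyle x hx')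
    · have hx' : -x ∈ Icc 0 s := ⟨by linarith, by linarith [hx.1]⟩
      have hne' : y (-x) ≠ 0 := by rw [hodd x hx]; exact neg_ne_zero.mpr hyx
      exact ((hynonneg _ hx').lt_of_ne hne'.symm).trans_le (hyle _ hx')
  obtain ⟨a, ha, hya⟩ : ∃ a ∈ Ioo 0 s, 0 < y a := by
    have hc : ContinuousWithinAt y (Icc 0 s) s :=
      (hydiff.continuousOn s hsK).mono (Icc_subset_Icc_left (by linarith))
    have hev : ∀ᶠ x in 𝓝[Ioo 0 s] s, 0 < y x :=
      (hc.mono Ioo_subset_Icc_self).eventually (lt_mem_nhds hys)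
    have : (𝓝[Ioo 0 s] s).NeBot := by
      rw [← mem_closure_iff_nhdsWithin_neBot, closure_Ioo hs0.ne]
      exact ⟨hs0.le, le_rfl⟩
    obtain ⟨x, hx, hmem⟩ := (hev.and self_mem_nhdsWithin).exists
    exact ⟨x, hmem, hx⟩
  by_contra! hμ
  set k := 2 * (1 - Real.sin s) with hk
  have hk0 : 0 ≤ k := by linarith [Real.sin_le_one s]
  let H : ℝ → ℝ := fun x => z x * Real.cos x * Real.sin x - Real.cos x ^ 2 * y x
    + k * y s * (Real.sin x ^ 2 / 2)
  have hHderiv : ∀ x ∈ Ioo 0 s, HasDerivAt H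
      (Real.cos x * Real.sin x * ((2 - μ) * y x + k * y s)) x := by
    intro x hx
    have h := (((hflux x hx).mul (Real.hasDerivAt_sin x)).sub
      (((Real.hasDerivAt_cos x).pow 2).mul (hyderiv x hx))).add
      ((((Real.hasDerivAt_sin x).pow 2).div_const 2).const_mul (k * y s))
    refine h.congr_deriv ?_
    change -(μ * Real.cos x * y x) * Real.sin x + z x * Real.cos x * Real.cos x
      - (((2 : ℕ) : ℝ) * Real.cos x ^ 1 * -Real.sin x * y x + Real.cos x ^ 2 * z x)
      + k * y s * (((2 : ℕ) : ℝ) * Real.sin x ^ 1 * Real.cos x / 2) = _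
    push_cast
    ring
  have hHcont : ContinuousOn H K := by
    have := hzdiff.continuousOn
    have := hydiff.continuousOn
    fun_prop
  have hcs : ∀ x ∈ Ioo 0 s, 0 < Real.cos x * Real.sin x := fun x hx =>
    mul_pos (Real.cos_pos_of_mem_Ioo ⟨by linarith [hx.1], by linarith [hx.2]⟩)
      (Real.sin_pos_of_pos_of_lt_pi hx.1 (by linarith [hx.2]))
  have hmonoH : MonotoneOn H (Icc 0 a) := by
    have hsub : Ioo 0 a ⊆ Ioo 0 s := Ioo_subset_Ioo_right ha.2.le
    refine monotoneOn_of_deriv_nonneg (convex_Icc 0 a)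
      (hHcont.mono (Icc_subset_Icc (by linarith) ha.2.le)) ?_ ?_
    · rw [interior_Icc]
      exact fun x hx => (hHderiv x (hsub hx)).differentiableAt.differentiableWithinAt
    · rw [interior_Icc]
      intro x hx
      have hx' := Ioo_subset_Icc_self (hsub hx)
      rw [(hHderiv x (hsub hx)).deriv]
      refine mul_nonneg (hcs x (hsub hx)).le ?_
      nlinarith [mul_nonneg (by linarith : 0 ≤ 2 - μ + k) (hynonneg x hx'),
        mul_nonneg hk0 (sub_nonneg.mpr (hyle x hx'))]
  have hstrictH : StrictMonoOn H (Icc a s) := by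
    refine strictMonoOn_of_deriv_pos (convex_Icc a s)
      (hHcont.mono (Icc_subset_Icc_left (by linarith [ha.1]))) ?_
    rw [interior_Icc]
    intro x hx
    have hx' : x ∈ Ioo 0 s := ⟨ha.1.trans hx.1, hx.2⟩
    have hxI := Ioo_subset_Icc_self hx'
    have hyx : 0 < y x := hya.trans_le (hymono (Ioo_subset_Icc_self ha) hxI hx.1.le)
    rw [(hHderiv x hx').deriv]
    refine mul_pos (hcs x hx') ?_
    nlinarith [mul_pos (by linarith : 0 < 2 - μ + k) hyx,
      mul_nonneg hk0 (sub_nonneg.mpr (hyle x hxI))]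
  have hlt : H 0 < H s :=
    (hmonoH ⟨le_rfl, ha.1.le⟩ ⟨ha.1.le, le_rfl⟩ ha.1.le).trans_lt
      (hstrictH ⟨le_rfl, ha.2.le⟩ ⟨ha.2.le, le_rfl⟩ ha.2)
  have hH0 : H 0 = 0 := by simp [H, hy0]
  have hHs : H s = -(y s * (1 - Real.sin s) * (1 + Real.sin s - Real.sin s ^ 2)) := by
    simp only [H, hbc2, Real.cos_sq', hk]
    ring
  have hsin0 : 0 ≤ Real.sin s := Real.sin_nonneg_of_nonneg_of_le_pi hs0.le (by linarith)
  have hfac : 0 ≤ 1 + Real.sin s - Real.sin s ^ 2 := by nlinarith [Real.sin_le_one s]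
  have := mul_nonneg (mul_nonneg hys.le (sub_nonneg.mpr (Real.sin_le_one s))) hfac
  linarith
end
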